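/- Let d ≥ 2, let v : [0,∞) → ℝ be an increasing continuously differentiable function, and let μ be the measure on ℝ^d with density e^{v(|x|)} with respect to Lebesgue measure. Fix r_0 > 0 and suppose there exists a continuously differentiable function f : [0,∞) → ℝ such that: (1) |f(r)| ≤ 1 for all r ≥ 0; (2) f(r_0) = 1; and (3) the function F(r) = f'(r) + f(r)·( v'(r) + (d−1)/r ) is increasing on (0,∞). Then for every bounded open set A ⊂ ℝ^d with smooth boundary satisfying μ(A) = μ(B_{r_0}), one has μ⁺(∂A) ≥ μ⁺(∂B_{r_0}), where B_{r_0} = {x : |x| ≤ r_0} is the closed ball of radius r_0 about the origin. -/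

import Mathlib

open MeasureTheory Metric Filter Set
open scoped ENNReal

/-- The (lower outer) surface measure `μ⁺(∂A) = liminf_{ε→0⁺} (μ(A^ε) − μ(A))/ε`,
where `A^ε` is the open `ε`-neighborhood of `A`. -/
noncomputable def surfaceMeasure {X : Type*} [PseudoEMetricSpace X] [MeasurableSpace X]
    (μ : Measure X) (A : Set X) : ℝ≥0∞ :=
  Filter.liminf (fun ε : ℝ => (μ (Metric.thickening ε A) - μ A) / ENNReal.ofReal ε)
    (nhdsWithin 0 (Set.Ioi 0))

/-- `A` has smooth boundary: near every boundary point, `A` is the sublevel set of a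
smooth function with nonvanishing differential. -/
def HasSmoothBoundary {d : ℕ} (A : Set (EuclideanSpace ℝ (Fin d))) : Prop :=
  ∀ x ∈ frontier A, ∃ U : Set (EuclideanSpace ℝ (Fin d)), IsOpen U ∧ x ∈ U ∧
    ∃ g : EuclideanSpace ℝ (Fin d) → ℝ, ContDiff ℝ (⊤ : ℕ∞) g ∧ (∀ y ∈ U, fderiv ℝ g y ≠ 0) ∧
      A ∩ U = {y | g y < 0} ∩ U

/-- The measure on `ℝ^d` with density `e^{v(|x|)}` with respect to Lebesgue measure. -/
noncomputable def radMeasure (d : ℕ) (v : ℝ → ℝ) : Measure (EuclideanSpace ℝ (Fin d)) :=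
  volume.withDensity fun x => ENNReal.ofReal (Real.exp (v ‖x‖))


section Aux

variable {d : ℕ}

lemma polar_lintegral (hd : 2 ≤ d) (G : EuclideanSpace ℝ (Fin d) → ℝ≥0∞) (hG : Measurable G) :
    ∫⁻ x, G x = ∫⁻ θ, (∫⁻ r in Ioi (0 : ℝ), ENNReal.ofReal (r ^ (d - 1)) *
      G (r • (θ : EuclideanSpace ℝ (Fin d))))
      ∂((volume : Measure (EuclideanSpace ℝ (Fin d))).toSphere) := by
  have : Nonempty (Fin d) := ⟨⟨0, by omega⟩⟩
  have h := (volume : Measure (EuclideanSpace ℝ (Fin d))).measurePreserving_homeomorphUnitSphereProd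
  rw [finrank_euclideanSpace_fin] at h
  have hsm : Measurable fun p : sphere (0 : EuclideanSpace ℝ (Fin d)) 1 × Ioi (0 : ℝ) =>
      G ((p.2 : ℝ) • (p.1 : EuclideanSpace ℝ (Fin d))) := by
    apply hG.comp
    fun_prop
  calc ∫⁻ x, G x = ∫⁻ x : ({(0)}ᶜ : Set (EuclideanSpace ℝ (Fin d))), G x
      ∂((volume : Measure (EuclideanSpace ℝ (Fin d))).comap (Subtype.val)) := by
        rw [lintegral_subtype_comap (measurableSet_singleton _).compl, restrict_compl_singleton]
    _ = ∫⁻ p, G ((p.2 : ℝ) • (p.1 : EuclideanSpace ℝ (Fin d)))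
          ∂((volume : Measure (EuclideanSpace ℝ (Fin d))).toSphere.prod
            (Measure.volumeIoiPow (d - 1))) := by
        rw [← h.lintegral_comp hsm]
        refine lintegral_congr fun x => ?_
        congr 1
        have hx : ‖(x : EuclideanSpace ℝ (Fin d))‖ ≠ 0 := norm_ne_zero_iff.2 x.2
        simp [homeomorphUnitSphereProd, smul_smul, hx]
    _ = _ := by
        rw [lintegral_prod _ hsm.aemeasurable]
        refine lintegral_congr fun θ => ?_
        have hm : Measurable fun r : ℝ => G (r • (θ : EuclideanSpace ℝ (Fin d))) := by
          apply hG.comp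
          fun_prop
        have hm2 : Measurable fun y : Ioi (0 : ℝ) =>
            G ((y : ℝ) • (θ : EuclideanSpace ℝ (Fin d))) := hm.comp measurable_subtype_coe
        simp only
        rw [Measure.volumeIoiPow, lintegral_withDensity_eq_lintegral_mul _ (by fun_prop) hm2]
        rw [← lintegral_subtype_comap measurableSet_Ioi]
        rfl

/-- Polar coordinates preimage. -/
def pol (B : Set (EuclideanSpace ℝ (Fin d))) :
    Set (sphere (0 : EuclideanSpace ℝ (Fin d)) 1 × ℝ) :=
  {p | 0 < p.2 ∧ p.2 • (p.1 : EuclideanSpace ℝ (Fin d)) ∈ B}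

/-- Radial weight. -/
noncomputable def wt (d : ℕ) (v : ℝ → ℝ) (r : ℝ) : ℝ :=
  (max r 0) ^ (d - 1) * Real.exp (v (max r 0))

/-- The measure on polar coordinates. -/
noncomputable def polQ (d : ℕ) : Measure (sphere (0 : EuclideanSpace ℝ (Fin d)) 1 × ℝ) :=
  ((volume : Measure (EuclideanSpace ℝ (Fin d))).toSphere).prod volume

lemma wt_nonneg (v : ℝ → ℝ) (r : ℝ) : 0 ≤ wt d v r := by unfold wt; positivity

lemma wt_nonpos (hd : 2 ≤ d) (v : ℝ → ℝ) {r : ℝ} (hr : r ≤ 0) : wt d v r = 0 := by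
  simp [wt, max_eq_right hr, show d - 1 ≠ 0 by omega]

lemma wt_cont {v : ℝ → ℝ} (hv : Continuous v) : Continuous (wt d v) := by
  unfold wt; fun_prop

lemma pol_meas {B : Set (EuclideanSpace ℝ (Fin d))} (hB : MeasurableSet B) :
    MeasurableSet (pol B) := by
  apply MeasurableSet.inter
  · exact measurableSet_lt measurable_const measurable_snd
  · have : Measurable fun p : sphere (0 : EuclideanSpace ℝ (Fin d)) 1 × ℝ =>
      p.2 • (p.1 : EuclideanSpace ℝ (Fin d)) := by fun_prop
    exact this hB

lemma setLIntegral_polQ {B : Set (sphere (0 : EuclideanSpace ℝ (Fin d)) 1 × ℝ)}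
    (hB : MeasurableSet B) {g : ℝ → ℝ≥0∞} (hg : Measurable g) :
    ∫⁻ p in B, g p.2 ∂(polQ d) = ∫⁻ θ, (∫⁻ r in {r | (θ, r) ∈ B}, g r)
      ∂((volume : Measure (EuclideanSpace ℝ (Fin d))).toSphere) := by
  have hm : Measurable (B.indicator fun p => g p.2) := (hg.comp measurable_snd).indicator hB
  rw [← lintegral_indicator hB, polQ, lintegral_prod _ hm.aemeasurable]
  refine lintegral_congr fun θ => ?_
  have hs : MeasurableSet {r | (θ, r) ∈ B} := measurable_prodMk_left hB
  rw [← lintegral_indicator hs]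
  rfl

lemma rad_eq (hd : 2 ≤ d) {v : ℝ → ℝ} (hv : Continuous v)
    {B : Set (EuclideanSpace ℝ (Fin d))} (hB : MeasurableSet B) :
    radMeasure d v B = ∫⁻ p in pol B, ENNReal.ofReal (wt d v p.2) ∂(polQ d) := by
  have hm : Measurable fun x : EuclideanSpace ℝ (Fin d) => ENNReal.ofReal (Real.exp (v ‖x‖)) := by
    fun_prop
  rw [radMeasure, withDensity_apply _ hB, ← lintegral_indicator hB,
    polar_lintegral hd _ (hm.indicator hB),
    setLIntegral_polQ (pol_meas hB) (g := fun r => ENNReal.ofReal (wt d v r))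
      (wt_cont hv).measurable.ennreal_ofReal]
  refine lintegral_congr fun θ => ?_
  have hs : MeasurableSet {r | (θ, r) ∈ pol B} := measurable_prodMk_left (pol_meas hB)
  rw [← lintegral_indicator measurableSet_Ioi, ← lintegral_indicator hs]
  refine lintegral_congr fun r => ?_
  by_cases hr : 0 < r
  · by_cases hb : r • (θ : EuclideanSpace ℝ (Fin d)) ∈ B
    · simp [indicator, pol, hr, hb, wt, norm_smul, abs_of_pos hr, max_eq_left hr.le,
        ENNReal.ofReal_mul (pow_nonneg hr.le _)]
    · simp [indicator, pol, hb]
  · simp [indicator, pol, hr]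

lemma mem_thick {A : Set (EuclideanSpace ℝ (Fin d))} (hA : IsOpen A) {ε : ℝ} (hε : 0 < ε)
    {x y : EuclideanSpace ℝ (Fin d)} (hx : x ∈ A) (hxy : ‖y - x‖ ≤ ε) : y ∈ thickening ε A := by
  obtain ⟨ρ, hρ, hb⟩ := Metric.isOpen_iff.1 hA x hx
  rw [mem_thickening_iff]
  set τ := min (1 / 2) (ρ / (2 * ε)) with hτ
  have h0 : 0 < τ := by positivity
  have h1 : τ ≤ 1 / 2 := min_le_left _ _
  have h2 : τ * (2 * ε) ≤ ρ := by
    have : τ ≤ ρ / (2 * ε) := min_le_right _ _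
    rwa [le_div_iff₀ (by positivity)] at this
  refine ⟨x + τ • (y - x), hb ?_, ?_⟩
  · rw [mem_ball, dist_eq_norm]
    simp only [add_sub_cancel_left, norm_smul, Real.norm_eq_abs, abs_of_pos h0]
    nlinarith
  · rw [dist_eq_norm, show y - (x + τ • (y - x)) = (1 - τ) • (y - x) by module, norm_smul,
      Real.norm_eq_abs, abs_of_pos (by linarith)]
    nlinarith [norm_nonneg (y - x)]

lemma lower (hd : 2 ≤ d) {v f f' : ℝ → ℝ} (hv : Continuous v) (hfc : Continuous f)
    (hfc' : Continuous f')
    (hf : ∀ r, 0 < r → HasDerivAt f (f' r) r) (hfb : ∀ r, |f r| ≤ 1)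
    {A : Set (EuclideanSpace ℝ (Fin d))} (hA : IsOpen A) {R K ε : ℝ}
    (hAR : A ⊆ ball 0 R) (hK : ∀ r ∈ Icc 0 R, |f' r| ≤ K) (hε : 0 < ε) (hεK : ε * K < 1) :
    ∫⁻ p in pol A, ENNReal.ofReal ((1 + ε * f' p.2) * wt d v (p.2 + ε * f p.2)) ∂(polQ d)
      ≤ radMeasure d v (thickening ε A) := by
  have hw := wt_cont (d := d) hv
  have hT : MeasurableSet (thickening ε A) := isOpen_thickening.measurableSet
  rw [rad_eq hd hv hT, setLIntegral_polQ (pol_meas hA.measurableSet)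
    (g := fun r => ENNReal.ofReal ((1 + ε * f' r) * wt d v (r + ε * f r))) (by fun_prop),
    setLIntegral_polQ (pol_meas hT) (g := fun r => ENNReal.ofReal (wt d v r)) (by fun_prop)]
  refine lintegral_mono fun θ => ?_
  set S : Set ℝ := {r | (θ, r) ∈ pol A} with hS
  have hSm : MeasurableSet S := measurable_prodMk_left (pol_meas hA.measurableSet)
  have hSR : S ⊆ Ioo 0 R := by
    rintro r ⟨hr, hr2⟩
    have := hAR hr2
    simp only at hr
    refine ⟨hr, ?_⟩
    simpa [norm_smul, abs_of_pos hr] using this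
  have hpos : ∀ r ∈ Ioo 0 R, 0 < 1 + ε * f' r := by
    intro r hr
    have := abs_le.1 (hK r ⟨hr.1.le, hr.2.le⟩)
    nlinarith
  have hder : ∀ r ∈ Ioo 0 R, HasDerivAt (fun r => r + ε * f r) (1 + ε * f' r) r := fun r hr =>
    (hasDerivAt_id r).add ((hf r hr.1).const_mul ε)
  have hmono : StrictMonoOn (fun r => r + ε * f r) (Ioo 0 R) := by
    apply strictMonoOn_of_deriv_pos (convex_Ioo _ _) (by fun_prop)
    intro r hr
    rw [interior_Ioo] at hr
    rw [(hder r hr).deriv]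
    exact hpos r hr
  have hcv := lintegral_image_eq_lintegral_abs_deriv_mul hSm
    (fun r hr => (hder r (hSR hr)).hasDerivWithinAt) (hmono.injOn.mono hSR)
    (fun r => ENNReal.ofReal (wt d v r))
  calc ∫⁻ r in S, ENNReal.ofReal ((1 + ε * f' r) * wt d v (r + ε * f r))
      = ∫⁻ r in S, ENNReal.ofReal |1 + ε * f' r| * ENNReal.ofReal (wt d v (r + ε * f r)) := by
        refine setLIntegral_congr_fun hSm fun r hr => ?_
        rw [abs_of_pos (hpos r (hSR hr)), ENNReal.ofReal_mul (hpos r (hSR hr)).le]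
    _ = ∫⁻ r in (fun r => r + ε * f r) '' S, ENNReal.ofReal (wt d v r) := hcv.symm
    _ ≤ ∫⁻ r in {r | (θ, r) ∈ pol (thickening ε A)} ∪ Iic 0, ENNReal.ofReal (wt d v r) := by
        apply lintegral_mono_set
        rintro _ ⟨r, hr, rfl⟩
        by_cases h : 0 < r + ε * f r
        · left
          refine ⟨h, mem_thick hA hε hr.2 ?_⟩
          have hθ : ‖(θ : EuclideanSpace ℝ (Fin d))‖ = 1 := by simp
          simp only
          rw [← sub_smul, norm_smul, hθ, add_sub_cancel_left, Real.norm_eq_abs, abs_mul,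
            abs_of_pos hε]
          nlinarith [hfb r]
        · right; exact not_lt.1 h
    _ ≤ (∫⁻ r in {r | (θ, r) ∈ pol (thickening ε A)}, ENNReal.ofReal (wt d v r))
          + ∫⁻ r in Iic 0, ENNReal.ofReal (wt d v r) := lintegral_union_le _ _ _
    _ = _ := by
        rw [setLIntegral_congr_fun (g := fun _ => 0) measurableSet_Iic
          (fun r hr => by simp [wt_nonpos hd v hr])]
        simp

/-- Derivative of the radial weight on the positive half line. -/
noncomputable def gd (d : ℕ) (v v' : ℝ → ℝ) (r : ℝ) : ℝ :=
  ((d - 1 : ℕ) : ℝ) * r ^ (d - 1 - 1) * Real.exp (v r) + r ^ (d - 1) * (Real.exp (v r) * v' r)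

lemma gd_cont {v v' : ℝ → ℝ} (hv : Continuous v) (hv' : Continuous v') :
    Continuous (gd d v v') := by
  unfold gd; fun_prop

lemma g_deriv {v v' : ℝ → ℝ} (hv : ∀ r ∈ Ici (0 : ℝ), HasDerivWithinAt v (v' r) (Ici 0) r)
    (r : ℝ) (hr : r ∈ Ici (0 : ℝ)) :
    HasDerivWithinAt (fun r => r ^ (d - 1) * Real.exp (v r)) (gd d v v' r) (Ici 0) r := by
  have h1 : HasDerivWithinAt (fun r : ℝ => r ^ (d - 1)) (((d - 1 : ℕ) : ℝ) * r ^ (d - 1 - 1))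
    (Ici 0) r := (hasDerivAt_pow (d - 1) r).hasDerivWithinAt
  exact h1.mul (hv r hr).exp

lemma wt_deriv {v v' : ℝ → ℝ} (hv : ∀ r ∈ Ici (0 : ℝ), HasDerivWithinAt v (v' r) (Ici 0) r)
    (r : ℝ) (hr : 0 < r) : HasDerivAt (wt d v) (gd d v v' r) r := by
  have h := (g_deriv (d := d) hv r hr.le).hasDerivAt (Ici_mem_nhds hr)
  refine h.congr_of_eventuallyEq ?_
  filter_upwards [Ioi_mem_nhds hr] with x hx
  simp [wt, max_eq_left (le_of_lt (mem_Ioi.1 hx))]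

lemma cont_bound {h : ℝ → ℝ} (hh : Continuous h) (a b : ℝ) :
    ∃ C, 0 ≤ C ∧ ∀ r ∈ Icc a b, |h r| ≤ C := by
  obtain ⟨C, hC⟩ := (isCompact_Icc (a := a) (b := b)).exists_bound_of_continuousOn hh.continuousOn
  exact ⟨max C 0, le_max_right _ _, fun r hr => (hC r hr).trans (le_max_left _ _)⟩

lemma wt_lip {v v' : ℝ → ℝ} (hvc : Continuous v) (hvc' : Continuous v')
    (hv : ∀ r ∈ Ici (0 : ℝ), HasDerivWithinAt v (v' r) (Ici 0) r) (R : ℝ) (hR : 0 ≤ R) :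
    ∃ L, 0 ≤ L ∧ ∀ a b, a ≤ R → b ≤ R → |wt d v a - wt d v b| ≤ L * |a - b| := by
  obtain ⟨L, hL, hb⟩ := cont_bound (gd_cont (d := d) hvc hvc') 0 R
  refine ⟨L, hL, fun a b ha hb' => ?_⟩
  have := Convex.norm_image_sub_le_of_norm_hasDerivWithin_le
    (f := fun r => r ^ (d - 1) * Real.exp (v r)) (f' := gd d v v') (s := Icc 0 R)
    (x := max b 0) (y := max a 0) (C := L)
    (fun x hx => (g_deriv hv x hx.1).mono Icc_subset_Ici_self) hb (convex_Icc _ _)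
    ⟨le_max_right _ _, max_le hb' hR⟩ ⟨le_max_right _ _, max_le ha hR⟩
  refine this.trans ?_
  gcongr
  exact abs_max_sub_max_le_abs a b 0

lemma pol_sub {A : Set (EuclideanSpace ℝ (Fin d))} {R : ℝ} (hAR : A ⊆ ball 0 R) :
    pol A ⊆ univ ×ˢ Ioo 0 R := by
  rintro ⟨θ, r⟩ ⟨hr, hr2⟩
  have := hAR hr2
  simp only at hr
  refine ⟨trivial, hr, ?_⟩
  simpa [norm_smul, abs_of_pos hr] using this

lemma pol_fin {A : Set (EuclideanSpace ℝ (Fin d))} {R : ℝ} (hAR : A ⊆ ball 0 R) :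
    polQ d (pol A) < ∞ := by
  refine (measure_mono (pol_sub hAR)).trans_lt ?_
  rw [polQ, Measure.prod_prod]
  exact ENNReal.mul_lt_top (measure_lt_top _ _) (by simp)

lemma int_on {A : Set (EuclideanSpace ℝ (Fin d))} (hA : MeasurableSet A) {R : ℝ}
    (hAR : A ⊆ ball 0 R) {h : ℝ → ℝ} (hh : Continuous h) :
    IntegrableOn (fun p => h p.2) (pol A) (polQ d) := by
  obtain ⟨C, -, hC⟩ := cont_bound hh 0 R
  refine IntegrableOn.of_bound (pol_fin hAR)
    (hh.comp continuous_snd).measurable.aestronglyMeasurable C ?_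
  filter_upwards [ae_restrict_mem (pol_meas hA)] with p hp
  have := (pol_sub hAR hp).2
  exact hC _ ⟨this.1.le, this.2.le⟩

lemma rad_real (hd : 2 ≤ d) {v : ℝ → ℝ} (hv : Continuous v)
    {A : Set (EuclideanSpace ℝ (Fin d))} (hA : MeasurableSet A) {R : ℝ} (hAR : A ⊆ ball 0 R) :
    radMeasure d v A = ENNReal.ofReal (∫ p in pol A, wt d v p.2 ∂(polQ d)) := by
  rw [rad_eq hd hv hA, ofReal_integral_eq_lintegral_ofReal (int_on hA hAR (wt_cont hv))]
  exact Eventually.of_forall fun p => wt_nonneg _ _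

lemma dct (hd : 2 ≤ d) {v v' f f' : ℝ → ℝ} (hvc : Continuous v) (hvc' : Continuous v')
    (hfc : Continuous f) (hfc' : Continuous f')
    (hv : ∀ r ∈ Ici (0 : ℝ), HasDerivWithinAt v (v' r) (Ici 0) r) (hfb : ∀ r, |f r| ≤ 1)
    {A : Set (EuclideanSpace ℝ (Fin d))} (hA : MeasurableSet A) {R : ℝ} (hR : 0 ≤ R)
    (hAR : A ⊆ ball 0 R) :
    Tendsto (fun ε : ℝ => ∫ p in pol A,
        ((1 + ε * f' p.2) * wt d v (p.2 + ε * f p.2) - wt d v p.2) / ε ∂(polQ d))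
      (nhdsWithin 0 (Ioi 0))
      (nhds (∫ p in pol A, (f' p.2 * wt d v p.2 + f p.2 * gd d v v' p.2) ∂(polQ d))) := by
  have hw := wt_cont (d := d) hvc
  obtain ⟨L, hL, hlip⟩ := wt_lip (d := d) hvc hvc' hv (R + 1) (by linarith)
  obtain ⟨K, hK, hKb⟩ := cont_bound hfc' 0 R
  obtain ⟨M, hM, hMb⟩ := cont_bound hw (-1) (R + 1)
  apply tendsto_integral_filter_of_dominated_convergence (fun _ => L + K * M)
  · refine Eventually.of_forall fun ε => ?_
    apply Measurable.aestronglyMeasurable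
    fun_prop
  · filter_upwards [Ioo_mem_nhdsGT (zero_lt_one' ℝ)] with ε hε
    filter_upwards [ae_restrict_mem (pol_meas hA)] with p hp
    obtain ⟨-, h0, h1⟩ := pol_sub hAR hp
    have hf1 := abs_le.1 (hfb p.2)
    have e1 : ε * f p.2 ≤ 1 := by nlinarith [hε.1, hε.2]
    have e2 : -1 ≤ ε * f p.2 := by nlinarith [hε.1, hε.2]
    have a1 := hlip (p.2 + ε * f p.2) p.2 (by linarith) (by linarith)
    have a2 := hMb (p.2 + ε * f p.2) ⟨by linarith, by linarith⟩
    have a3 := hKb p.2 ⟨h0.le, h1.le⟩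
    rw [Real.norm_eq_abs, abs_div, abs_of_pos hε.1, div_le_iff₀ hε.1]
    have a4 : |f' p.2 * wt d v (p.2 + ε * f p.2)| ≤ K * M := by
      rw [abs_mul]; gcongr
    have a5 : |p.2 + ε * f p.2 - p.2| ≤ ε := by
      rw [add_sub_cancel_left, abs_mul, abs_of_pos hε.1]
      nlinarith [hfb p.2, hε.1]
    calc _ = |(wt d v (p.2 + ε * f p.2) - wt d v p.2)
            + ε * (f' p.2 * wt d v (p.2 + ε * f p.2))| := by congr 1; ring
      _ ≤ |wt d v (p.2 + ε * f p.2) - wt d v p.2|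
            + |ε * (f' p.2 * wt d v (p.2 + ε * f p.2))| := abs_add_le _ _
      _ ≤ L * ε + ε * (K * M) := by
          rw [abs_mul ε, abs_of_pos hε.1]
          have := hε.1
          gcongr
          exact a1.trans (by gcongr)
      _ = _ := by ring
  · exact integrableOn_const (pol_fin hAR).ne
  · filter_upwards [ae_restrict_mem (pol_meas hA)] with p hp
    obtain ⟨-, h0, h1⟩ := pol_sub hAR hp
    have k1 : HasDerivAt (fun ε : ℝ => 1 + ε * f' p.2) (f' p.2) 0 := by
      simpa using ((hasDerivAt_id (0 : ℝ)).mul_const (f' p.2)).const_add 1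
    have k2 : HasDerivAt (fun ε : ℝ => p.2 + ε * f p.2) (f p.2) 0 := by
      simpa using ((hasDerivAt_id (0 : ℝ)).mul_const (f p.2)).const_add p.2
    have k3 : HasDerivAt (fun ε : ℝ => wt d v (p.2 + ε * f p.2)) (gd d v v' p.2 * f p.2) 0 := by
      have k0 : HasDerivAt (wt d v) (gd d v v' p.2) (p.2 + 0 * f p.2) := by
        simpa using wt_deriv (d := d) hv p.2 h0
      exact HasDerivAt.comp (0 : ℝ) k0 k2
    have k4 := (k1.mul k3).tendsto_slope_zero_right
    simp only [Pi.mul_apply, zero_add, zero_mul, add_zero, one_mul, smul_eq_mul] at k4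
    convert k4 using 2
    · rw [div_eq_inv_mul]
    · ring

lemma lower_bound (hd : 2 ≤ d) {v v' f f' : ℝ → ℝ} (hvc : Continuous v) (hvc' : Continuous v')
    (hfc : Continuous f) (hfc' : Continuous f')
    (hv : ∀ r ∈ Ici (0 : ℝ), HasDerivWithinAt v (v' r) (Ici 0) r)
    (hf : ∀ r ∈ Ici (0 : ℝ), HasDerivWithinAt f (f' r) (Ici 0) r) (hfb : ∀ r, |f r| ≤ 1)
    {A : Set (EuclideanSpace ℝ (Fin d))} (hA : IsOpen A) {R : ℝ} (hR : 0 ≤ R)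
    (hAR : A ⊆ ball 0 R) :
    ENNReal.ofReal (∫ p in pol A, (f' p.2 * wt d v p.2 + f p.2 * gd d v v' p.2) ∂(polQ d)) ≤
      surfaceMeasure (radMeasure d v) A := by
  have hw := wt_cont (d := d) hvc
  have hlim := (ENNReal.continuous_ofReal.tendsto _).comp
    (dct hd hvc hvc' hfc hfc' hv hfb hA.measurableSet hR hAR)
  rw [← hlim.liminf_eq, surfaceMeasure]
  obtain ⟨K, hK, hKb⟩ := cont_bound hfc' 0 R
  refine liminf_le_liminf ?_
  filter_upwards [Ioo_mem_nhdsGT (show (0 : ℝ) < 1 / (K + 1) by positivity)] with ε hε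
  have hεK : ε * K < 1 := by
    have := hε.2
    rw [lt_div_iff₀ (by positivity)] at this
    nlinarith [hε.1]
  have hl := lower hd hvc hfc hfc' (fun r hr => (hf r hr.le).hasDerivAt (Ici_mem_nhds hr)) hfb hA
    hAR hKb hε.1 hεK
  have i1 : IntegrableOn (fun p => (1 + ε * f' p.2) * wt d v (p.2 + ε * f p.2)) (pol A) (polQ d) :=
    int_on hA.measurableSet hAR (h := fun r => (1 + ε * f' r) * wt d v (r + ε * f r)) (by fun_prop)
  have i2 := int_on hA.measurableSet hAR hw
  rw [← ofReal_integral_eq_lintegral_ofReal i1 ?_] at hl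
  · rw [rad_real hd hvc hA.measurableSet hAR]
    simp only [Function.comp]
    rw [integral_div, integral_sub i1 i2, ENNReal.ofReal_div_of_pos hε.1, ENNReal.ofReal_sub]
    · gcongr
    · exact integral_nonneg fun p => wt_nonneg _ _
  · filter_upwards [ae_restrict_mem (pol_meas hA.measurableSet)] with p hp
    obtain ⟨-, h0, h1⟩ := pol_sub hAR hp
    have := abs_le.1 (hKb p.2 ⟨h0.le, h1.le⟩)
    have : 0 ≤ 1 + ε * f' p.2 := by nlinarith [hε.1]
    exact mul_nonneg this (wt_nonneg _ _)

lemma pol_closedBall (ρ : ℝ) :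
    pol (closedBall (0 : EuclideanSpace ℝ (Fin d)) ρ) = univ ×ˢ Ioc 0 ρ := by
  ext ⟨θ, r⟩
  simp only [pol, mem_setOf_eq, mem_prod, mem_univ, true_and, mem_Ioc]
  refine and_congr_right fun hr => ?_
  simp [norm_smul, abs_of_pos hr]

lemma pol_ball (ρ : ℝ) :
    pol (ball (0 : EuclideanSpace ℝ (Fin d)) ρ) = univ ×ˢ Ioo 0 ρ := by
  ext ⟨θ, r⟩
  simp only [pol, mem_setOf_eq, mem_prod, mem_univ, true_and, mem_Ioo]
  refine and_congr_right fun hr => ?_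
  simp [norm_smul, abs_of_pos hr]

lemma int_closedBall {h : ℝ → ℝ} (hh : Continuous h) {ρ : ℝ} (hρ : 0 < ρ) :
    ∫ p in pol (closedBall (0 : EuclideanSpace ℝ (Fin d)) ρ), h p.2 ∂(polQ d) =
      ((volume : Measure (EuclideanSpace ℝ (Fin d))).toSphere).real univ * ∫ r in 0..ρ, h r := by
  have hi := int_on (d := d) (A := closedBall 0 ρ) isClosed_closedBall.measurableSet
    (closedBall_subset_ball (lt_add_one ρ)) hh
  rw [pol_closedBall, polQ] at hi ⊢
  rw [setIntegral_prod _ hi, intervalIntegral.integral_of_le hρ.le]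
  simp

lemma int_ball {h : ℝ → ℝ} (hh : Continuous h) {ρ : ℝ} (hρ : 0 < ρ) :
    ∫ p in pol (ball (0 : EuclideanSpace ℝ (Fin d)) ρ), h p.2 ∂(polQ d) =
      ((volume : Measure (EuclideanSpace ℝ (Fin d))).toSphere).real univ * ∫ r in 0..ρ, h r := by
  have hi := int_on (d := d) (A := ball 0 ρ) isOpen_ball.measurableSet subset_rfl hh
  rw [pol_ball, polQ] at hi ⊢
  rw [setIntegral_prod _ hi, intervalIntegral.integral_of_le hρ.le]
  simp [integral_Ioc_eq_integral_Ioo]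

lemma surf_ball (hd : 2 ≤ d) {v : ℝ → ℝ} (hvc : Continuous v) {r0 : ℝ} (hr0 : 0 < r0) :
    surfaceMeasure (radMeasure d v) (closedBall (0 : EuclideanSpace ℝ (Fin d)) r0) =
      ENNReal.ofReal (((volume : Measure (EuclideanSpace ℝ (Fin d))).toSphere).real univ *
        wt d v r0) := by
  have hw := wt_cont (d := d) hvc
  set s := ((volume : Measure (EuclideanSpace ℝ (Fin d))).toSphere).real univ with hs
  have hs0 : 0 ≤ s := measureReal_nonneg
  have hder : HasDerivAt (fun ρ => ∫ r in 0..ρ, wt d v r) (wt d v r0) r0 :=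
    (hw.integral_hasStrictDerivAt 0 r0).hasDerivAt
  have hlim := (ENNReal.continuous_ofReal.tendsto _).comp
    ((hder.const_mul s).tendsto_slope_zero_right)
  rw [← hlim.liminf_eq, surfaceMeasure]
  refine liminf_congr ?_
  filter_upwards [self_mem_nhdsWithin] with ε hε
  have hε : 0 < ε := hε
  have hpos : 0 ≤ ∫ r in 0..r0, wt d v r :=
    intervalIntegral.integral_nonneg hr0.le fun r _ => wt_nonneg v r
  rw [thickening_closedBall hε hr0.le, rad_real hd hvc isOpen_ball.measurableSet subset_rfl,
    rad_real hd hvc isClosed_closedBall.measurableSet (closedBall_subset_ball (lt_add_one r0)),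
    int_ball hw (by linarith), int_closedBall hw hr0, ← ENNReal.ofReal_sub _ (by positivity),
    ← ENNReal.ofReal_div_of_pos hε]
  simp only [Function.comp, smul_eq_mul]
  rw [div_eq_inv_mul, add_comm ε]

theorem core (hd : 2 ≤ d) {v v' f f' : ℝ → ℝ} (hvc : Continuous v) (hvc' : Continuous v')
    (hfc : Continuous f) (hfc' : Continuous f')
    (hv : ∀ r ∈ Ici (0 : ℝ), HasDerivWithinAt v (v' r) (Ici 0) r)
    (hf : ∀ r ∈ Ici (0 : ℝ), HasDerivWithinAt f (f' r) (Ici 0) r) (hfb : ∀ r, |f r| ≤ 1)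
    {r0 : ℝ} (hr0 : 0 < r0) (hfr0 : f r0 = 1)
    (hFmono : MonotoneOn (fun r => f' r + f r * (v' r + (d - 1) / r)) (Ioi 0))
    {A : Set (EuclideanSpace ℝ (Fin d))} (hAbd : Bornology.IsBounded A) (hA : IsOpen A)
    (hvol : radMeasure d v A = radMeasure d v (closedBall (0 : EuclideanSpace ℝ (Fin d)) r0)) :
    surfaceMeasure (radMeasure d v) (closedBall (0 : EuclideanSpace ℝ (Fin d)) r0) ≤
      surfaceMeasure (radMeasure d v) A := by
  have hw := wt_cont (d := d) hvc
  have hg := gd_cont (d := d) hvc hvc'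
  obtain ⟨R, hR⟩ := hAbd.subset_ball_lt 0 0
  obtain ⟨hR, hAR⟩ := hR
  refine le_trans ?_ (lower_bound hd hvc hvc' hfc hfc' hv hf hfb hA hR.le hAR)
  rw [surf_ball hd hvc hr0]
  apply ENNReal.ofReal_le_ofReal
  set D : ℝ → ℝ := fun r => f' r * wt d v r + f r * gd d v v' r with hD
  have hDc : Continuous D := by fun_prop
  set F : ℝ → ℝ := fun r => f' r + f r * (v' r + (d - 1) / r) with hF
  have hDF : ∀ r, 0 < r → D r = F r * wt d v r := by
    intro r hr
    obtain ⟨n, rfl⟩ : ∃ n, d = n + 2 := ⟨d - 2, by omega⟩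
    simp only [hD, hF, wt, gd, max_eq_left hr.le, show n + 2 - 1 = n + 1 by omega,
      show n + 1 - 1 = n by omega]
    push_cast
    field_simp
    ring
  have hBm : MeasurableSet (closedBall (0 : EuclideanSpace ℝ (Fin d)) r0) :=
    isClosed_closedBall.measurableSet
  have hBR := closedBall_subset_ball (x := (0 : EuclideanSpace ℝ (Fin d))) (lt_add_one r0)
  -- the flux through the sphere
  have hflux : ∫ p in pol (closedBall (0 : EuclideanSpace ℝ (Fin d)) r0), D p.2 ∂(polQ d) =
      ((volume : Measure (EuclideanSpace ℝ (Fin d))).toSphere).real univ * wt d v r0 := by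
    rw [int_closedBall hDc hr0]
    congr 1
    rw [intervalIntegral.integral_eq_sub_of_hasDerivAt_of_le (f := fun r => f r * wt d v r) hr0.le
      (by fun_prop) (f' := D) ?_ (hDc.intervalIntegrable _ _)]
    · simp [hfr0, wt_nonpos hd v le_rfl]
    · intro r hr
      exact ((hf r hr.1.le).hasDerivAt (Ici_mem_nhds hr.1)).mul (wt_deriv hv r hr.1)
  rw [← hflux]
  -- equality of volumes
  have hvol' : ∫ p in pol A, wt d v p.2 ∂(polQ d) =
      ∫ p in pol (closedBall (0 : EuclideanSpace ℝ (Fin d)) r0), wt d v p.2 ∂(polQ d) := by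
    rw [rad_real hd hvc hA.measurableSet hAR, rad_real hd hvc hBm hBR] at hvol
    exact (ENNReal.ofReal_eq_ofReal_iff (integral_nonneg fun p => wt_nonneg _ _)
      (integral_nonneg fun p => wt_nonneg _ _)).1 hvol
  have hE : Continuous fun r => D r - F r0 * wt d v r := by fun_prop
  have jA := int_on hA.measurableSet hAR hE
  have jB := int_on hBm hBR hE
  have key : ∫ p in pol (closedBall (0 : EuclideanSpace ℝ (Fin d)) r0),
      (D p.2 - F r0 * wt d v p.2) ∂(polQ d) ≤
      ∫ p in pol A, (D p.2 - F r0 * wt d v p.2) ∂(polQ d) := by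
    rw [← integral_indicator (pol_meas hBm), ← integral_indicator (pol_meas hA.measurableSet)]
    refine integral_mono (jB.integrable_indicator (pol_meas hBm))
      (jA.integrable_indicator (pol_meas hA.measurableSet)) ?_
    rintro ⟨θ, r⟩
    by_cases hr : 0 < r
    · have hw0 := wt_nonneg (d := d) v r
      have hrw : D r - F r0 * wt d v r = (F r - F r0) * wt d v r := by rw [hDF r hr]; ring
      rw [pol_closedBall]
      simp only [indicator, mem_prod, mem_univ, true_and, mem_Ioc, hr, hrw]
      by_cases hle : r ≤ r0
      · have := hFmono (mem_Ioi.2 hr) (mem_Ioi.2 hr0) hle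
        have : (F r - F r0) * wt d v r ≤ 0 :=
          mul_nonpos_of_nonpos_of_nonneg (by linarith) hw0
        simp only [hle, if_true]
        split_ifs <;> linarith
      · have := hFmono (mem_Ioi.2 hr0) (mem_Ioi.2 hr) (not_le.1 hle).le
        have : 0 ≤ (F r - F r0) * wt d v r := mul_nonneg (by linarith) hw0
        simp only [hle, if_false]
        split_ifs <;> linarith
    · simp [indicator, pol, hr]
  rw [integral_sub (int_on hBm hBR hDc) ((int_on hBm hBR hw).const_mul _),
    integral_sub (int_on hA.measurableSet hAR hDc) ((int_on hA.measurableSet hAR hw).const_mul _),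
    integral_const_mul, integral_const_mul, hvol'] at key
  linarith

end Aux

theorem stmt_10 (d : ℕ) (hd : 2 ≤ d) (v v' f f' : ℝ → ℝ)
    (hv : ∀ r ∈ Set.Ici (0 : ℝ), HasDerivWithinAt v (v' r) (Set.Ici 0) r)
    (hv'cont : ContinuousOn v' (Set.Ici 0))
    (hvmono : MonotoneOn v (Set.Ici 0))
    (hf : ∀ r ∈ Set.Ici (0 : ℝ), HasDerivWithinAt f (f' r) (Set.Ici 0) r)
    (hf'cont : ContinuousOn f' (Set.Ici 0))
    (r0 : ℝ) (hr0 : 0 < r0)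
    (hfbound : ∀ r ∈ Set.Ici (0 : ℝ), |f r| ≤ 1)
    (hfr0 : f r0 = 1)
    (hFmono : MonotoneOn (fun r => f' r + f r * (v' r + (d - 1) / r)) (Set.Ioi 0))
    (A : Set (EuclideanSpace ℝ (Fin d)))
    (hAbd : Bornology.IsBounded A) (hAopen : IsOpen A) (hAsm : HasSmoothBoundary A)
    (hvol : radMeasure d v A =
      radMeasure d v (Metric.closedBall (0 : EuclideanSpace ℝ (Fin d)) r0)) :
    surfaceMeasure (radMeasure d v) (Metric.closedBall (0 : EuclideanSpace ℝ (Fin d)) r0) ≤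
      surfaceMeasure (radMeasure d v) A := by
  have hmx : Continuous fun r : ℝ => max r 0 := by fun_prop
  have hmem : ∀ r : ℝ, max r 0 ∈ Set.Ici (0 : ℝ) := fun r => Set.mem_Ici.2 (le_max_right _ _)
  have ext_cont : ∀ h : ℝ → ℝ, ContinuousOn h (Set.Ici 0) → Continuous fun r => h (max r 0) :=
    fun h hh => hh.comp_continuous hmx hmem
  have ext_der : ∀ h h' : ℝ → ℝ,
      (∀ r ∈ Set.Ici (0 : ℝ), HasDerivWithinAt h (h' r) (Set.Ici 0) r) →
      ∀ r ∈ Set.Ici (0 : ℝ),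
        HasDerivWithinAt (fun r => h (max r 0)) (h' (max r 0)) (Set.Ici 0) r := by
    intro h h' hh r hr
    have hr' : (0 : ℝ) ≤ r := Set.mem_Ici.1 hr
    rw [max_eq_left hr']
    refine (hh r hr).congr (fun x hx => ?_) ?_
    · rw [max_eq_left (Set.mem_Ici.1 hx)]
    · rw [max_eq_left hr']
  have hrad : radMeasure d v = radMeasure d (fun r => v (max r 0)) := by
    unfold radMeasure
    simp only [max_eq_left (norm_nonneg _)]
  rw [hrad] at hvol ⊢
  refine core hd (ext_cont v fun r hr => (hv r hr).continuousWithinAt) (ext_cont v' hv'cont)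
    (ext_cont f fun r hr => (hf r hr).continuousWithinAt) (ext_cont f' hf'cont)
    (ext_der v v' hv) (ext_der f f' hf) (fun r => hfbound _ (hmem r)) hr0
    (by simpa [max_eq_left hr0.le] using hfr0) ?_ hAbd hAopen hvol
  refine hFmono.congr fun r hr => ?_
  simp only [max_eq_left (le_of_lt (Set.mem_Ioi.1 hr))]
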